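/- (Decrease at transmission instants.) Consider the noise-free networked control loop under bounded packet dropouts: successful transmission instants k_0 = 0 < k_1 < k_2 < … with m_i := k_{i+1} − k_i − 1 ≤ N − 1 for all i; at each k_i a packet u(x(k_i)) ∈ F_W(x(k_i)) is buffered, and the plant input for k = k_i + l (l = 0,…,m_i) is the (l+1)-th entry of that packet, so x(k+1) = Ax(k) + Bu(k). If 0 < ℰ < (1−ρ)P/c, then for every i with x(k_i) ≠ 0: V(x(k)) < V(x(k_i)) for all k = k_i + 1,…,k_i + m_i + 1; in particular the sequence V(x(k_i)) is strictly decreasing (while nonzero) and x(k_i) → 0 as i → ∞. -/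

import Mathlib

open Matrix Filter Topology

noncomputable section

/-- The block lower-triangular matrix `Φ ∈ ℝ^{nN×N}` whose (i,j)-th `n×1` block
(0-indexed) is `A^{i-j}B` for `i ≥ j` and `0` otherwise. -/
def Phi (n N : ℕ) (A : Matrix (Fin n) (Fin n) ℝ) (B : Fin n → ℝ) :
    Matrix (Fin N × Fin n) (Fin N) ℝ :=
  Matrix.of fun p j =>
    if (j : ℕ) ≤ (p.1 : ℕ) then ((A ^ ((p.1 : ℕ) - (j : ℕ))) *ᵥ B) p.2 else 0

/-- `Φ_i ∈ ℝ^{n×N}`, the (i+1)-th row block of `Φ`,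
i.e. `Φ_i = [A^i B, A^{i-1} B, …, B, 0, …, 0]`. -/
def PhiBlock (n N : ℕ) (A : Matrix (Fin n) (Fin n) ℝ) (B : Fin n → ℝ) (i : Fin N) :
    Matrix (Fin n) (Fin N) ℝ :=
  Matrix.of fun r j => Phi n N A B (i, r) j

/-- `Υ := [A; A²; …; A^N] ∈ ℝ^{nN×n}`. -/
def Upsilon (n N : ℕ) (A : Matrix (Fin n) (Fin n) ℝ) :
    Matrix (Fin N × Fin n) (Fin n) ℝ :=
  Matrix.of fun p s => (A ^ ((p.1 : ℕ) + 1)) p.2 s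

/-- `Q̄ := blockdiag(Q, …, Q, P)` with `N−1` copies of `Q` followed by `P`. -/
def Qbar (n N : ℕ) (Q P : Matrix (Fin n) (Fin n) ℝ) :
    Matrix (Fin N × Fin n) (Fin N × Fin n) ℝ :=
  Matrix.of fun p q =>
    if p.1 = q.1 then (if (p.1 : ℕ) = N - 1 then P else Q) p.2 q.2 else 0

/-- The cost `u ↦ ‖Gu − Hx‖₂²`. -/
def Jcost {n N : ℕ} (G : Matrix (Fin N × Fin n) (Fin N) ℝ)
    (H : Matrix (Fin N × Fin n) (Fin n) ℝ) (x : Fin n → ℝ) (u : Fin N → ℝ) : ℝ :=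
  (G *ᵥ u - H *ᵥ x) ⬝ᵥ (G *ᵥ u - H *ᵥ x)

/-- The feasible set `F_W(x) := {u ∈ ℝ^N : ‖Gu − Hx‖₂² ≤ xᵀWx}`. -/
def Feas {n N : ℕ} (G : Matrix (Fin N × Fin n) (Fin N) ℝ)
    (H : Matrix (Fin N × Fin n) (Fin n) ℝ) (W : Matrix (Fin n) (Fin n) ℝ)
    (x : Fin n → ℝ) : Set (Fin N → ℝ) :=
  {u | Jcost G H x u ≤ x ⬝ᵥ (W *ᵥ x)}

/-- The least-squares solution `u*(x) := (GᵀG)⁻¹GᵀHx`. -/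
def uStar {n N : ℕ} (G : Matrix (Fin N × Fin n) (Fin N) ℝ)
    (H : Matrix (Fin N × Fin n) (Fin n) ℝ) (x : Fin n → ℝ) : Fin N → ℝ :=
  ((Gᵀ * G)⁻¹ * Gᵀ * H) *ᵥ x

/-- The LQ gain (row vector) `K := −(BᵀPB)⁻¹BᵀPA`. -/
def Kgain {n : ℕ} (A P : Matrix (Fin n) (Fin n) ℝ) (B : Fin n → ℝ) : Fin n → ℝ :=
  -((B ⬝ᵥ (P *ᵥ B))⁻¹ • Matrix.vecMul B (P * A))

/-- The closed-loop matrix `A + BK`. -/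
def Acl {n : ℕ} (A P : Matrix (Fin n) (Fin n) ℝ) (B : Fin n → ℝ) :
    Matrix (Fin n) (Fin n) ℝ :=
  A + Matrix.vecMulVec B (Kgain A P B)

/-- The discrete algebraic Riccati equation
`P = AᵀPA − AᵀPB(BᵀPB)⁻¹BᵀPA + Q`. -/
def Riccati {n : ℕ} (A P Q : Matrix (Fin n) (Fin n) ℝ) (B : Fin n → ℝ) : Prop :=
  P = Aᵀ * P * A -
      (B ⬝ᵥ (P *ᵥ B))⁻¹ •
        Matrix.vecMulVec (Aᵀ *ᵥ (P *ᵥ B)) (Matrix.vecMul B (P * A)) + Q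

/-- The Lyapunov function `V(x) := xᵀPx`. -/
def Vfun {n : ℕ} (P : Matrix (Fin n) (Fin n) ℝ) (x : Fin n → ℝ) : ℝ :=
  x ⬝ᵥ (P *ᵥ x)

/-- `c₁ := max_{i=0,…,N−1} λ_max(Φᵢᵀ P Φᵢ (GᵀG)⁻¹)`. -/
def c1const (n N : ℕ) (A P : Matrix (Fin n) (Fin n) ℝ) (B : Fin n → ℝ)
    (G : Matrix (Fin N × Fin n) (Fin N) ℝ) : ℝ :=
  ⨆ i : Fin N,
    sSup (spectrum ℝ ((PhiBlock n N A B i)ᵀ * P * PhiBlock n N A B i * (Gᵀ * G)⁻¹))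

/-- `ρ := 1 − λ_min(QP⁻¹)`. -/
def rhoConst {n : ℕ} (Q P : Matrix (Fin n) (Fin n) ℝ) : ℝ :=
  1 - sInf (spectrum ℝ (Q * P⁻¹))

/-- `c := (1−ρ)⁻¹(1−ρ^N)c₁`. -/
def cConst (n N : ℕ) (A P Q : Matrix (Fin n) (Fin n) ℝ) (B : Fin n → ℝ)
    (G : Matrix (Fin N × Fin n) (Fin N) ℝ) : ℝ :=
  (1 - rhoConst Q P)⁻¹ * (1 - rhoConst Q P ^ N) * c1const n N A P B G

/-- `w_i := ε_i − K Σ_{l=0}^{i−1} A^{i−1−l} B ε_l`. -/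
def wErr {n N : ℕ} (A P : Matrix (Fin n) (Fin n) ℝ) (B : Fin n → ℝ)
    (ε : Fin N → ℝ) (i : Fin N) : ℝ :=
  ε i - Kgain A P B ⬝ᵥ
    (∑ l ∈ Finset.univ.filter (fun l : Fin N => (l : ℕ) < (i : ℕ)),
      ε l • ((A ^ ((i : ℕ) - 1 - (l : ℕ))) *ᵥ B))

/-- The controllability matrix `[B, AB, …, A^{n−1}B]`. -/
def Ctrb {n : ℕ} (A : Matrix (Fin n) (Fin n) ℝ) (B : Fin n → ℝ) :
    Matrix (Fin n) (Fin n) ℝ :=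
  Matrix.of fun r j => ((A ^ (j : ℕ)) *ᵥ B) r

lemma aux_gen_min {n : ℕ} (hn : Nonempty (Fin n)) (Q P : Matrix (Fin n) (Fin n) ℝ)
    (hQ : Q.PosDef) (hP : P.PosDef) :
    0 < sInf (spectrum ℝ (Q * P⁻¹)) ∧
    ∀ x : Fin n → ℝ, sInf (spectrum ℝ (Q * P⁻¹)) * (x ⬝ᵥ (P *ᵥ x)) ≤ x ⬝ᵥ (Q *ᵥ x) := by
  obtain ⟨C, hC, hPC⟩ : ∃ C : Matrix (Fin n) (Fin n) ℝ, IsUnit C ∧ P = Cᵀ * C := by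
    open scoped MatrixOrder Matrix.Norms.L2Operator in
    obtain ⟨y, hy, h⟩ := CStarAlgebra.isStrictlyPositive_iff_eq_star_mul_self.mp
        hP.isStrictlyPositive
    exact ⟨y, hy, by rw [h, star_eq_conjTranspose, conjTranspose_eq_transpose_of_trivial]⟩
  have hCd : IsUnit C.det := (Matrix.isUnit_iff_isUnit_det C).1 hC
  set T := C⁻¹ᵀ * (Q * C⁻¹) with hT
  have hTpd : T.PosDef := by
    have h := hQ.conjTranspose_mul_mul_same (B := C⁻¹) (by
      apply Matrix.mulVec_injective_of_isUnit
      exact (Matrix.isUnit_nonsing_inv_iff).2 hC)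
    rw [conjTranspose_eq_transpose_of_trivial, Matrix.mul_assoc] at h
    exact h
  have hPinv : P⁻¹ = C⁻¹ * C⁻¹ᵀ := by
    rw [hPC, Matrix.mul_inv_rev, Matrix.transpose_nonsing_inv]
  have hspec : spectrum ℝ (Q * P⁻¹) = spectrum ℝ T := by
    ext r
    rw [Matrix.mem_spectrum_iff_isRoot_charpoly, Matrix.mem_spectrum_iff_isRoot_charpoly, hT,
      Matrix.charpoly_mul_comm C⁻¹ᵀ, hPinv, Matrix.mul_assoc]
  rw [hspec]
  have hfin : (spectrum ℝ T).Finite := Matrix.finite_spectrum T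
  have hr := hTpd.1.spectrum_real_eq_range_eigenvalues
  have hne : (spectrum ℝ T).Nonempty := by
    rw [hr]; exact Set.range_nonempty _
  have hmem := hne.csInf_mem hfin
  constructor
  · rw [hr] at hmem ⊢
    obtain ⟨i, hi⟩ := hmem
    rw [← hi]
    exact hTpd.eigenvalues_pos i
  · intro x
    set μ := sInf (spectrum ℝ T) with hμ
    have hps : (T - algebraMap ℝ _ μ).PosSemidef := by
      rw [posSemidef_iff_isHermitian_and_spectrum_nonneg]
      constructor
      · apply IsHermitian.sub hTpd.1
        rw [Matrix.algebraMap_eq_diagonal]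
        exact Matrix.isHermitian_diagonal _
      · rw [← spectrum.sub_singleton_eq]
        rintro a ⟨b, hb, c, hc, rfl⟩
        have := csInf_le hfin.bddBelow hb
        simp only [Set.mem_singleton_iff] at hc
        subst hc
        simpa using this
    have h := hps.dotProduct_mulVec_nonneg (C *ᵥ x)
    have hCi : C⁻¹ * C = 1 := Matrix.nonsing_inv_mul C hCd
    have h1 : (C *ᵥ x) ⬝ᵥ (T *ᵥ (C *ᵥ x)) = x ⬝ᵥ (Q *ᵥ x) := by
      have : Cᵀ * C⁻¹ᵀ = 1 := by rw [← Matrix.transpose_mul, hCi, Matrix.transpose_one]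
      rw [← Matrix.vecMul_transpose, ← Matrix.dotProduct_mulVec, Matrix.vecMul_transpose,
        Matrix.mulVec_mulVec, Matrix.mulVec_mulVec, hT, ← Matrix.mul_assoc, ← Matrix.mul_assoc, this, Matrix.one_mul,
        Matrix.mul_assoc, hCi, Matrix.mul_one]
    have h2 : (C *ᵥ x) ⬝ᵥ (C *ᵥ x) = x ⬝ᵥ (P *ᵥ x) := by
      rw [← Matrix.vecMul_transpose, ← Matrix.dotProduct_mulVec, Matrix.vecMul_transpose,
        Matrix.mulVec_mulVec, hPC]
    rw [Matrix.sub_mulVec, dotProduct_sub, star_trivial, h1, Matrix.algebraMap_eq_diagonal] at h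
    have h3 : (Matrix.diagonal (algebraMap ℝ (Fin n → ℝ) μ)) *ᵥ (C *ᵥ x) = μ • (C *ᵥ x) := by
      ext i; simp [Matrix.mulVec_diagonal]
    rw [h3, dotProduct_smul, h2, smul_eq_mul] at h
    linarith

/-- The bilinear Riccati completion-of-squares identity. -/
lemma aux_step {n : ℕ} (A P Q : Matrix (Fin n) (Fin n) ℝ) (B : Fin n → ℝ) (hB : B ≠ 0)
    (hP : P.PosDef) (hRic : Riccati A P Q B) (x y : Fin n → ℝ) (u v : ℝ) :
    (A *ᵥ x + u • B) ⬝ᵥ (P *ᵥ (A *ᵥ y + v • B)) =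
      x ⬝ᵥ (P *ᵥ y) - x ⬝ᵥ (Q *ᵥ y) +
      (B ⬝ᵥ (P *ᵥ B)) * ((u - Kgain A P B ⬝ᵥ x) * (v - Kgain A P B ⬝ᵥ y)) := by
  have hb : 0 < B ⬝ᵥ (P *ᵥ B) := by simpa using hP.dotProduct_mulVec_pos hB
  have hsym : ∀ a c : Fin n → ℝ, a ⬝ᵥ (P *ᵥ c) = c ⬝ᵥ (P *ᵥ a) := by
    intro a c
    have : Pᵀ = P := by
      have := hP.1.eq; rwa [conjTranspose_eq_transpose_of_trivial] at this
    rw [Matrix.dotProduct_mulVec, dotProduct_comm, ← Matrix.mulVec_transpose, this]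
  have hK : ∀ z : Fin n → ℝ, Kgain A P B ⬝ᵥ z =
      -((B ⬝ᵥ (P *ᵥ B))⁻¹ * (B ⬝ᵥ (P *ᵥ (A *ᵥ z)))) := by
    intro z
    rw [Kgain, neg_dotProduct, smul_dotProduct, smul_eq_mul, ← Matrix.dotProduct_mulVec,
      Matrix.mulVec_mulVec]
  have hR : x ⬝ᵥ (P *ᵥ y) = (A *ᵥ x) ⬝ᵥ (P *ᵥ (A *ᵥ y)) - (B ⬝ᵥ (P *ᵥ B))⁻¹ *
      ((B ⬝ᵥ (P *ᵥ (A *ᵥ x))) * (B ⬝ᵥ (P *ᵥ (A *ᵥ y)))) + x ⬝ᵥ (Q *ᵥ y) := by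
    have h := congrArg (fun M => x ⬝ᵥ (M *ᵥ y)) hRic
    simp only [Matrix.add_mulVec, Matrix.sub_mulVec, dotProduct_add, dotProduct_sub,
      Matrix.smul_mulVec, dotProduct_smul, smul_eq_mul] at h
    have e1 : x ⬝ᵥ ((Aᵀ * P * A) *ᵥ y) = (A *ᵥ x) ⬝ᵥ (P *ᵥ (A *ᵥ y)) := by
      rw [← Matrix.mulVec_mulVec, ← Matrix.mulVec_mulVec, Matrix.dotProduct_mulVec,
        Matrix.vecMul_transpose]
    have e2 : x ⬝ᵥ (Matrix.vecMulVec (Aᵀ *ᵥ (P *ᵥ B)) (Matrix.vecMul B (P * A)) *ᵥ y) =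
        (B ⬝ᵥ (P *ᵥ (A *ᵥ x))) * (B ⬝ᵥ (P *ᵥ (A *ᵥ y))) := by
      rw [Matrix.vecMulVec_mulVec]
      have e3 : x ⬝ᵥ (Aᵀ *ᵥ (P *ᵥ B)) = B ⬝ᵥ (P *ᵥ (A *ᵥ x)) := by
        rw [Matrix.dotProduct_mulVec, Matrix.vecMul_transpose, hsym]
      have e4 : Matrix.vecMul B (P * A) ⬝ᵥ y = B ⬝ᵥ (P *ᵥ (A *ᵥ y)) := by
        rw [← Matrix.dotProduct_mulVec, Matrix.mulVec_mulVec]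
      rw [e4]
      simp only [op_smul_eq_smul, dotProduct_smul, smul_eq_mul, e3]
      ring
    rw [e1, e2] at h
    exact h
  rw [hR, hK, hK, Matrix.mulVec_add, Matrix.mulVec_smul, add_dotProduct, dotProduct_add,
    dotProduct_add, smul_dotProduct, smul_dotProduct, dotProduct_smul, dotProduct_smul,
    hsym (A *ᵥ x) B]
  simp only [smul_eq_mul]
  field_simp
  ring

lemma aux_sum {n : ℕ} (A P Q : Matrix (Fin n) (Fin n) ℝ) (B : Fin n → ℝ) (hB : B ≠ 0)
    (hP : P.PosDef) (hRic : Riccati A P Q B) (x y : ℕ → Fin n → ℝ) (u v : ℕ → ℝ)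
    (hx : ∀ t, x (t + 1) = A *ᵥ x t + u t • B) (hy : ∀ t, y (t + 1) = A *ᵥ y t + v t • B)
    (m : ℕ) :
    x m ⬝ᵥ (P *ᵥ y m) + ∑ j ∈ Finset.range m, x j ⬝ᵥ (Q *ᵥ y j) =
      x 0 ⬝ᵥ (P *ᵥ y 0) + (B ⬝ᵥ (P *ᵥ B)) * ∑ j ∈ Finset.range m,
        (u j - Kgain A P B ⬝ᵥ x j) * (v j - Kgain A P B ⬝ᵥ y j) := by
  induction m with
  | zero => simp
  | succ m ih =>
    rw [Finset.sum_range_succ, Finset.sum_range_succ, hx, hy, aux_step A P Q B hB hP hRic]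
    linarith

lemma aux_sol {n : ℕ} (A : Matrix (Fin n) (Fin n) ℝ) (B : Fin n → ℝ)
    (x : ℕ → Fin n → ℝ) (u : ℕ → ℝ) (hx : ∀ t, x (t + 1) = A *ᵥ x t + u t • B) (m : ℕ) :
    x m = (A ^ m) *ᵥ x 0 + ∑ j ∈ Finset.range m, u j • ((A ^ (m - 1 - j)) *ᵥ B) := by
  induction m with
  | zero => simp
  | succ m ih =>
    rw [hx, Finset.sum_range_succ]
    conv_lhs => rw [ih]
    rw [Matrix.mulVec_add, Matrix.mulVec_mulVec, ← pow_succ', Matrix.mulVec_sum]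
    simp only [Nat.add_sub_cancel, Nat.sub_self, pow_zero, Matrix.one_mulVec]
    rw [add_assoc]
    congr 2
    apply Finset.sum_congr rfl
    intro j hj
    rw [Matrix.mulVec_smul, Matrix.mulVec_mulVec, ← pow_succ']
    have := Finset.mem_range.1 hj
    congr 3
    omega

lemma aux_block {n N : ℕ} (A : Matrix (Fin n) (Fin n) ℝ) (B : Fin n → ℝ)
    (x : ℕ → Fin n → ℝ) (u : ℕ → ℝ) (hx : ∀ t, x (t + 1) = A *ᵥ x t + u t • B) :
    Phi n N A B *ᵥ (fun j : Fin N => u j) + Upsilon n N A *ᵥ x 0 =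
      fun p => x ((p.1 : ℕ) + 1) p.2 := by
  ext ⟨i, r⟩
  rw [aux_sol A B x u hx ((i : ℕ) + 1)]
  simp only [Pi.add_apply, Finset.sum_apply, Pi.smul_apply, smul_eq_mul]
  rw [add_comm]
  congr 1
  simp only [Matrix.mulVec, dotProduct, Phi, Matrix.of_apply]
  rw [Fin.sum_univ_eq_sum_range (fun j => (if j ≤ (i : ℕ) then
    ∑ s, (A ^ ((i : ℕ) - j)) r s * B s else 0) * u j) N]
  symm
  have hi := i.2
  rw [← Finset.sum_subset (Finset.range_subset_range.2 (show (i : ℕ) + 1 ≤ N by omega))]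
  · apply Finset.sum_congr rfl
    intro j hj
    have := Finset.mem_range.1 hj
    rw [if_pos (by omega), mul_comm, Nat.add_sub_cancel]
  · intro j _ hj
    rw [if_neg, zero_mul]
    simp at hj
    omega

lemma aux_cost {n N : ℕ} (hN : 1 ≤ N) (P Q : Matrix (Fin n) (Fin n) ℝ)
    (S : Matrix (Fin N × Fin n) (Fin N × Fin n) ℝ)
    (hS : S.PosSemidef) (hSsq : S * S = Qbar n N Q P) (x y : ℕ → Fin n → ℝ) :
    (S *ᵥ (fun p : Fin N × Fin n => x ((p.1 : ℕ) + 1) p.2)) ⬝ᵥ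
      (S *ᵥ (fun p : Fin N × Fin n => y ((p.1 : ℕ) + 1) p.2)) =
    x N ⬝ᵥ (P *ᵥ y N) + ∑ j ∈ Finset.range (N - 1), x (j + 1) ⬝ᵥ (Q *ᵥ y (j + 1)) := by
  have hSt : Sᵀ = S := by
    have := hS.1.eq; rwa [conjTranspose_eq_transpose_of_trivial] at this
  have h0 : ∀ a c : Fin N × Fin n → ℝ, (S *ᵥ a) ⬝ᵥ (S *ᵥ c) = a ⬝ᵥ (Qbar n N Q P *ᵥ c) := by
    intro a c
    rw [Matrix.dotProduct_mulVec, ← Matrix.mulVec_transpose, hSt, Matrix.mulVec_mulVec, hSsq,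
      ← hSsq, ← Matrix.mulVec_mulVec]
    nth_rewrite 1 [← hSt]
    rw [Matrix.mulVec_transpose, ← Matrix.dotProduct_mulVec]
    nth_rewrite 1 [← hSt]
    rw [Matrix.mulVec_transpose, ← Matrix.dotProduct_mulVec, Matrix.mulVec_mulVec]
  have h : ∀ p : Fin N × Fin n,
      (Qbar n N Q P *ᵥ (fun p : Fin N × Fin n => y ((p.1 : ℕ) + 1) p.2)) p =
      ((if (p.1 : ℕ) = N - 1 then P else Q) *ᵥ y ((p.1 : ℕ) + 1)) p.2 := by
    rintro ⟨i, r⟩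
    simp only [Matrix.mulVec, dotProduct, Qbar, Matrix.of_apply, Fintype.sum_prod_type]
    rw [Finset.sum_eq_single i]
    · simp
    · intro j _ hj
      simp [Ne.symm hj]
    · simp
  rw [h0]
  have h2 : (fun p : Fin N × Fin n => x ((p.1 : ℕ) + 1) p.2) ⬝ᵥ
      (Qbar n N Q P *ᵥ (fun p : Fin N × Fin n => y ((p.1 : ℕ) + 1) p.2)) =
      ∑ i : Fin N, x ((i : ℕ) + 1) ⬝ᵥ
        ((if (i : ℕ) = N - 1 then P else Q) *ᵥ y ((i : ℕ) + 1)) := by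
    simp only [dotProduct, h, Fintype.sum_prod_type]
  rw [h2, Fin.sum_univ_eq_sum_range (fun i => x (i + 1) ⬝ᵥ
        ((if i = N - 1 then P else Q) *ᵥ y (i + 1))) N]
  obtain ⟨M, rfl⟩ : ∃ M, N = M + 1 := ⟨N - 1, by omega⟩
  rw [Finset.sum_range_succ, add_comm]
  simp only [Nat.add_sub_cancel, if_true]
  congr 1
  apply Finset.sum_congr rfl
  intro j hj
  have := Finset.mem_range.1 hj
  rw [if_neg (by omega)]

lemma aux_J {n N : ℕ} (hN : 1 ≤ N) (A P Q : Matrix (Fin n) (Fin n) ℝ) (B : Fin n → ℝ)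
    (hB : B ≠ 0) (hP : P.PosDef) (hRic : Riccati A P Q B)
    (S : Matrix (Fin N × Fin n) (Fin N × Fin n) ℝ)
    (hS : S.PosSemidef) (hSsq : S * S = Qbar n N Q P)
    (G : Matrix (Fin N × Fin n) (Fin N) ℝ) (hG : G = S * Phi n N A B)
    (H : Matrix (Fin N × Fin n) (Fin n) ℝ) (hH : H = -(S * Upsilon n N A))
    (x y : ℕ → Fin n → ℝ) (u v : ℕ → ℝ)
    (hx : ∀ t, x (t + 1) = A *ᵥ x t + u t • B) (hy : ∀ t, y (t + 1) = A *ᵥ y t + v t • B) :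
    (G *ᵥ (fun j : Fin N => u j) - H *ᵥ x 0) ⬝ᵥ (G *ᵥ (fun j : Fin N => v j) - H *ᵥ y 0) =
      x 0 ⬝ᵥ (P *ᵥ y 0) - x 0 ⬝ᵥ (Q *ᵥ y 0) + (B ⬝ᵥ (P *ᵥ B)) * ∑ j ∈ Finset.range N,
        (u j - Kgain A P B ⬝ᵥ x j) * (v j - Kgain A P B ⬝ᵥ y j) := by
  have e : ∀ (z : ℕ → Fin n → ℝ) (w : ℕ → ℝ), (∀ t, z (t + 1) = A *ᵥ z t + w t • B) →
      G *ᵥ (fun j : Fin N => w j) - H *ᵥ z 0 =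
        S *ᵥ (fun p : Fin N × Fin n => z ((p.1 : ℕ) + 1) p.2) := by
    intro z w hz
    rw [← aux_block A B z w hz, hG, hH, Matrix.neg_mulVec, sub_neg_eq_add, Matrix.mulVec_add,
      Matrix.mulVec_mulVec, Matrix.mulVec_mulVec]
  rw [e x u hx, e y v hy, aux_cost hN P Q S hS hSsq]
  have h := aux_sum A P Q B hB hP hRic x y u v hx hy N
  obtain ⟨M, rfl⟩ : ∃ M, N = M + 1 := ⟨N - 1, by omega⟩
  rw [Finset.sum_range_succ' (fun j => x j ⬝ᵥ (Q *ᵥ y j))] at h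
  rw [Nat.add_sub_cancel]
  linarith

/-- Open-loop trajectory from `x0` under the input sequence `u`. -/
def auxTraj {n : ℕ} (A : Matrix (Fin n) (Fin n) ℝ) (B x0 : Fin n → ℝ) (u : ℕ → ℝ) :
    ℕ → Fin n → ℝ
  | 0 => x0
  | t + 1 => A *ᵥ auxTraj A B x0 u t + u t • B

/-- Trajectory from `0` with unit deviation from the feedback at time `0`. -/
def auxImp {n : ℕ} (A P : Matrix (Fin n) (Fin n) ℝ) (B : Fin n → ℝ) : ℕ → Fin n → ℝ
  | 0 => 0
  | t + 1 => A *ᵥ auxImp A P B t + (if t = 0 then 1 else Kgain A P B ⬝ᵥ auxImp A P B t) • B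

/-- Extension of a packet by zero. -/
def auxExt {N : ℕ} (u : Fin N → ℝ) : ℕ → ℝ := fun t => if h : t < N then u ⟨t, h⟩ else 0

lemma auxExt_coe {N : ℕ} (u : Fin N → ℝ) : (fun j : Fin N => auxExt u j) = u := by
  ext j; simp [auxExt]

lemma aux_c1 {n N : ℕ} (hN : 1 ≤ N) (A P Q : Matrix (Fin n) (Fin n) ℝ) (B : Fin n → ℝ)
    (hB : B ≠ 0) (hP : P.PosDef) (hRic : Riccati A P Q B)
    (S : Matrix (Fin N × Fin n) (Fin N × Fin n) ℝ)
    (hS : S.PosSemidef) (hSsq : S * S = Qbar n N Q P)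
    (G : Matrix (Fin N × Fin n) (Fin N) ℝ) (hG : G = S * Phi n N A B) :
    1 ≤ c1const n N A P B G := by
  have hb : 0 < B ⬝ᵥ (P *ᵥ B) := by simpa using hP.dotProduct_mulVec_pos hB
  have hGG : ∀ a c : Fin N → ℝ, a ⬝ᵥ ((Gᵀ * G) *ᵥ c) = (G *ᵥ a) ⬝ᵥ (G *ᵥ c) := by
    intro a c
    rw [← Matrix.mulVec_mulVec, Matrix.dotProduct_mulVec, Matrix.vecMul_transpose]
  have hJ : ∀ (x y : ℕ → Fin n → ℝ) (u v : ℕ → ℝ), x 0 = 0 → y 0 = 0 →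
      (∀ t, x (t + 1) = A *ᵥ x t + u t • B) → (∀ t, y (t + 1) = A *ᵥ y t + v t • B) →
      (fun j : Fin N => u j) ⬝ᵥ ((Gᵀ * G) *ᵥ (fun j : Fin N => v j)) =
      (B ⬝ᵥ (P *ᵥ B)) * ∑ j ∈ Finset.range N,
        (u j - Kgain A P B ⬝ᵥ x j) * (v j - Kgain A P B ⬝ᵥ y j) := by
    intro x y u v hx0 hy0 hx hy
    have h := aux_J hN A P Q B hB hP hRic S hS hSsq G hG _ rfl x y u v hx hy
    rw [hx0, hy0] at h
    simp only [Matrix.mulVec_zero, sub_zero, zero_dotProduct, zero_add] at h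
    rw [hGG, h]
  have hinj : IsUnit (Gᵀ * G) := by
    rw [← Matrix.mulVec_injective_iff_isUnit]
    have hz : ∀ a : Fin N → ℝ, (Gᵀ * G) *ᵥ a = 0 → a = 0 := by
      intro a ha
      have h := hJ (auxTraj A B 0 (auxExt a)) (auxTraj A B 0 (auxExt a)) (auxExt a) (auxExt a)
        rfl rfl (fun t => rfl) (fun t => rfl)
      rw [auxExt_coe, ha, dotProduct_zero, eq_comm, mul_eq_zero, or_iff_right hb.ne',
        Finset.sum_eq_zero_iff_of_nonneg (fun j _ => mul_self_nonneg _)] at h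
      have hw : ∀ t, t < N → auxExt a t = Kgain A P B ⬝ᵥ auxTraj A B 0 (auxExt a) t := by
        intro t ht
        have := h t (Finset.mem_range.2 ht)
        exact sub_eq_zero.1 (mul_self_eq_zero.1 this)
      have hx : ∀ t, t ≤ N → auxTraj A B 0 (auxExt a) t = 0 := by
        intro t
        induction t with
        | zero => intro _; rfl
        | succ t ih =>
          intro ht
          have h0 := ih (by omega)
          rw [auxTraj, hw t (by omega), h0]
          simp
      ext j
      have := hw j j.2
      rw [hx j j.2.le, dotProduct_zero] at this
      simpa [auxExt] using this
    intro a c hac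
    apply sub_eq_zero.1
    apply hz
    rw [Matrix.mulVec_sub]
    exact sub_eq_zero.2 hac
  set v : ℕ → ℝ := fun t => if t = 0 then 1 else Kgain A P B ⬝ᵥ auxImp A P B t with hv
  set i0 : Fin N := ⟨0, hN⟩ with hi0
  have h1 : (Gᵀ * G) *ᵥ (fun j : Fin N => v j) = Pi.single i0 (B ⬝ᵥ (P *ᵥ B)) := by
    have hall : ∀ u : Fin N → ℝ, u ⬝ᵥ ((Gᵀ * G) *ᵥ (fun j : Fin N => v j)) =
        u ⬝ᵥ Pi.single i0 (B ⬝ᵥ (P *ᵥ B)) := by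
      intro u
      have h := hJ (auxTraj A B 0 (auxExt u)) (auxImp A P B) (auxExt u) v rfl rfl
        (fun t => rfl) (fun t => rfl)
      rw [auxExt_coe] at h
      rw [h, dotProduct_single, Finset.sum_eq_single 0]
      · simp [auxTraj, auxImp, hv, auxExt, hi0, show 0 < N from hN, mul_comm]
      · intro j _ hj
        simp [hv, hj]
      · intro h; simp at h; omega
    exact dotProduct_eq _ _ (fun w => by rw [dotProduct_comm, hall, dotProduct_comm])
  have h2 : ((PhiBlock n N A B i0)ᵀ * P * PhiBlock n N A B i0) *ᵥ (fun j : Fin N => v j) =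
      Pi.single i0 (B ⬝ᵥ (P *ᵥ B)) := by
    have e1 : PhiBlock n N A B i0 *ᵥ (fun j : Fin N => v j) = B := by
      ext r
      simp only [Matrix.mulVec, dotProduct, PhiBlock, Phi, Matrix.of_apply]
      rw [Finset.sum_eq_single i0]
      · simp [hi0, hv, Matrix.one_apply]
      · intro j _ hj
        rw [if_neg, zero_mul]
        intro hle
        exact hj (Fin.ext (by simpa [hi0] using hle))
      · simp
    rw [← Matrix.mulVec_mulVec, ← Matrix.mulVec_mulVec, e1]
    ext j
    by_cases hj : j = i0
    · subst hj
      simp [Matrix.mulVec, dotProduct, PhiBlock, Phi, Matrix.one_apply, hi0]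
    · rw [Pi.single_eq_of_ne hj]
      have : ¬ ((j : ℕ) ≤ 0) := fun hle => hj (Fin.ext (by simpa [hi0] using hle))
      simp only [Matrix.mulVec, dotProduct, PhiBlock, Phi, Matrix.of_apply, Matrix.transpose_apply]
      apply Finset.sum_eq_zero
      intro r _
      rw [if_neg (by simpa [hi0] using this), zero_mul]
  have hmem : (1 : ℝ) ∈ spectrum ℝ
      ((PhiBlock n N A B i0)ᵀ * P * PhiBlock n N A B i0 * (Gᵀ * G)⁻¹) := by
    rw [← Matrix.spectrum_toLin']
    apply Module.End.HasEigenvalue.mem_spectrum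
    apply Module.End.hasEigenvalue_of_hasEigenvector (x := Pi.single i0 (B ⬝ᵥ (P *ᵥ B)))
    refine ⟨?_, ?_⟩
    · rw [Module.End.mem_eigenspace_iff, one_smul, Matrix.toLin'_apply]
      nth_rewrite 1 [← h1]
      rw [Matrix.mulVec_mulVec, Matrix.mul_assoc,
        Matrix.nonsing_inv_mul _ ((Matrix.isUnit_iff_isUnit_det _).1 hinj), Matrix.mul_one, h2]
    · simpa using hb.ne'
  have hle := le_csSup (Matrix.finite_spectrum _).bddAbove hmem
  refine hle.trans ?_
  exact le_ciSup (f := fun i : Fin N => sSup (spectrum ℝ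
    ((PhiBlock n N A B i)ᵀ * P * PhiBlock n N A B i * (Gᵀ * G)⁻¹)))
    (Set.finite_range _).bddAbove i0

/-- Decrease at transmission instants: In the noise-free
networked loop with bounded packet dropouts (successful instants `k_0 = 0 <
k_1 < …` with `m_i := k_{i+1} − k_i − 1 ≤ N − 1`), buffered feasible packets
and `x(k+1) = Ax(k) + Bu(k)`, if `0 < ℰ < (1−ρ)P/c` then for every `i` with
`x(k_i) ≠ 0`: `V(x(k)) < V(x(k_i))` for all `k = k_i+1, …, k_i+m_i+1`; in
particular `V(x(k_i))` is strictly decreasing (while nonzero) and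
`x(k_i) → 0` as `i → ∞`. -/
theorem decrease_at_transmission_instants {n N : ℕ} (hN : 1 ≤ N)
    (A : Matrix (Fin n) (Fin n) ℝ) (B : Fin n → ℝ) (hB : B ≠ 0)
    (Q P : Matrix (Fin n) (Fin n) ℝ) (hQ : Q.PosDef) (hP : P.PosDef)
    (hRic : Riccati A P Q B)
    (S : Matrix (Fin N × Fin n) (Fin N × Fin n) ℝ)
    (hS : S.PosSemidef) (hSsq : S * S = Qbar n N Q P)
    (G : Matrix (Fin N × Fin n) (Fin N) ℝ) (hG : G = S * Phi n N A B)
    (H : Matrix (Fin N × Fin n) (Fin n) ℝ) (hH : H = -(S * Upsilon n N A))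
    (E : Matrix (Fin n) (Fin n) ℝ) (hE : E.PosDef)
    (hEub : (((1 - rhoConst Q P) / cConst n N A P Q B G) • P - E).PosDef)
    (k : ℕ → ℕ) (hk0 : k 0 = 0) (hkmono : StrictMono k)
    (hkbound : ∀ i : ℕ, k (i + 1) ≤ k i + N)
    (U : ℕ → Fin N → ℝ) (uin : ℕ → ℝ) (xst : ℕ → Fin n → ℝ)
    (hfeas : ∀ i : ℕ, U i ∈ Feas G H ((P - Q) + E) (xst (k i)))
    (hinput : ∀ (i : ℕ) (l : Fin N),
      k i + (l : ℕ) < k (i + 1) → uin (k i + (l : ℕ)) = U i l)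
    (hdyn : ∀ t : ℕ, xst (t + 1) = A *ᵥ xst t + uin t • B) :
    (∀ i : ℕ, xst (k i) ≠ 0 →
        ∀ t : ℕ, k i < t → t ≤ k (i + 1) →
          Vfun P (xst t) < Vfun P (xst (k i))) ∧
    (∀ i : ℕ, xst (k i) ≠ 0 →
        Vfun P (xst (k (i + 1))) < Vfun P (xst (k i))) ∧
    Filter.Tendsto (fun i : ℕ => xst (k i)) Filter.atTop (nhds 0) := by
  have hb : 0 < B ⬝ᵥ (P *ᵥ B) := by simpa using hP.dotProduct_mulVec_pos hB
  have hn : Nonempty (Fin n) := by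
    obtain ⟨i, _⟩ := Function.ne_iff.1 hB
    exact ⟨i⟩
  have hpd : ∀ (M : Matrix (Fin n) (Fin n) ℝ), M.PosDef → ∀ x : Fin n → ℝ, x ≠ 0 →
      0 < x ⬝ᵥ (M *ᵥ x) := by
    intro M hM x hx
    simpa using hM.dotProduct_mulVec_pos hx
  have hps : ∀ (M : Matrix (Fin n) (Fin n) ℝ), M.PosDef → ∀ x : Fin n → ℝ,
      0 ≤ x ⬝ᵥ (M *ᵥ x) := by
    intro M hM x
    simpa using hM.posSemidef.dotProduct_mulVec_nonneg x
  obtain ⟨hμ0, hμQ⟩ := aux_gen_min hn Q P hQ hP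
  have hc1 := aux_c1 hN A P Q B hB hP hRic S hS hSsq G hG
  set μ := sInf (spectrum ℝ (Q * P⁻¹)) with hμ
  have hρ : rhoConst Q P = 1 - μ := rfl
  have hμ1 : μ ≤ 1 := by
    have h1 := aux_step A P Q B hB hP hRic B B (Kgain A P B ⬝ᵥ B) (Kgain A P B ⬝ᵥ B)
    have h2 := hps P hP (A *ᵥ B + (Kgain A P B ⬝ᵥ B) • B)
    have h3 := hμQ B
    rw [h1, sub_self, mul_zero, mul_zero, add_zero] at h2
    by_contra hcon
    nlinarith
  have hcge : 1 ≤ cConst n N A P Q B G := by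
    rw [cConst, hρ]
    have hp : (1 - μ) ^ N ≤ 1 - μ := by
      have := pow_le_pow_of_le_one (show 0 ≤ 1 - μ by linarith) (by linarith) hN
      simpa using this
    have h1 : 1 ≤ (1 - (1 - μ))⁻¹ * (1 - (1 - μ) ^ N) := by
      rw [sub_sub_cancel, inv_mul_eq_div, le_div_iff₀ hμ0]
      linarith
    nlinarith
  have hθ : (1 - rhoConst Q P) / cConst n N A P Q B G ≤ μ := by
    rw [hρ, sub_sub_cancel]
    exact div_le_self hμ0.le hcge
  have hDpos : ∀ x : Fin n → ℝ, x ≠ 0 → 0 < x ⬝ᵥ ((Q - E) *ᵥ x) := by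
    intro x hx
    have h1 := hpd _ hEub x hx
    have h2 := hμQ x
    have h3 := hpd P hP x hx
    rw [Matrix.sub_mulVec, dotProduct_sub, Matrix.smul_mulVec, dotProduct_smul, smul_eq_mul] at h1
    rw [Matrix.sub_mulVec, dotProduct_sub]
    nlinarith
  have hD : (Q - E).PosDef := by
    apply PosDef.of_dotProduct_mulVec_pos (hQ.1.sub hE.1)
    intro x hx
    simpa using hDpos x hx
  -- the key estimate
  have key : ∀ i t : ℕ, k i < t → t ≤ k (i + 1) →
      Vfun P (xst t) ≤ Vfun P (xst (k i)) - xst (k i) ⬝ᵥ ((Q - E) *ᵥ xst (k i)) := by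
    intro i t ht1 ht2
    set x := auxTraj A B (xst (k i)) (auxExt (U i)) with hx
    have hxd : ∀ t, x (t + 1) = A *ᵥ x t + auxExt (U i) t • B := fun t => rfl
    have hx0 : x 0 = xst (k i) := rfl
    have heq : ∀ l, k i + l ≤ k (i + 1) → xst (k i + l) = x l := by
      intro l
      induction l with
      | zero => intro _; rfl
      | succ l ih =>
        intro hl
        have hlN : l < N := by have := hkbound i; omega
        have hu := hinput i ⟨l, hlN⟩ (by simp only; omega)
        rw [← Nat.add_assoc, hdyn, ih (by omega), hxd]
        simp only at hu
        rw [hu]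
        simp [auxExt, hlN]
    obtain ⟨m, rfl⟩ : ∃ m, t = k i + (m + 1) := ⟨t - k i - 1, by omega⟩
    have hmN : m + 1 ≤ N := by have := hkbound i; omega
    rw [heq (m + 1) ht2]
    have hJ := aux_J hN A P Q B hB hP hRic S hS hSsq G hG H hH x x _ _ hxd hxd
    have hf : Jcost G H (xst (k i)) (U i) ≤ _ := hfeas i
    rw [auxExt_coe, hx0] at hJ
    rw [Jcost, hJ] at hf
    have hs := aux_sum A P Q B hB hP hRic x x _ _ hxd hxd (m + 1)
    rw [Finset.sum_range_succ', hx0] at hs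
    have hnn : 0 ≤ ∑ j ∈ Finset.range m, x (j + 1) ⬝ᵥ (Q *ᵥ x (j + 1)) :=
      Finset.sum_nonneg (fun j _ => hps Q hQ _)
    have hle := Finset.sum_le_sum_of_subset_of_nonneg (Finset.range_subset_range.2 hmN)
      (f := fun j => (auxExt (U i) j - Kgain A P B ⬝ᵥ x j) *
        (auxExt (U i) j - Kgain A P B ⬝ᵥ x j)) (fun j _ _ => mul_self_nonneg _)
    have hle2 := mul_le_mul_of_nonneg_left hle hb.le
    rw [Matrix.add_mulVec, Matrix.sub_mulVec, dotProduct_add, dotProduct_sub] at hf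
    rw [Matrix.sub_mulVec, dotProduct_sub, Vfun, Vfun]
    linarith
  have part1 : ∀ i : ℕ, xst (k i) ≠ 0 → ∀ t : ℕ, k i < t → t ≤ k (i + 1) →
      Vfun P (xst t) < Vfun P (xst (k i)) := by
    intro i hi t ht1 ht2
    have h1 := key i t ht1 ht2
    have h2 := hDpos _ hi
    linarith
  refine ⟨part1, fun i hi => part1 i hi _ (hkmono (Nat.lt_succ_self i)) le_rfl, ?_⟩
  set a : ℕ → ℝ := fun i => xst (k i) ⬝ᵥ ((Q - E) *ᵥ xst (k i)) with ha
  have ha0 : ∀ i, 0 ≤ a i := fun i => hps _ hD _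
  have hsum : ∀ m, ∑ i ∈ Finset.range m, a i ≤ Vfun P (xst (k 0)) - Vfun P (xst (k m)) := by
    intro m
    induction m with
    | zero => simp
    | succ m ih =>
      rw [Finset.sum_range_succ]
      have := key m (k (m + 1)) (hkmono (Nat.lt_succ_self m)) le_rfl
      have e : a m = xst (k m) ⬝ᵥ ((Q - E) *ᵥ xst (k m)) := rfl
      linarith
  have hsm : Summable a := summable_of_sum_range_le ha0 (c := Vfun P (xst (k 0))) (by
    intro m
    have h1 := hsum m
    have h2 : 0 ≤ Vfun P (xst (k m)) := hps P hP _
    linarith)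
  have hlim := hsm.tendsto_atTop_zero
  obtain ⟨hν0, hνD⟩ := aux_gen_min hn (Q - E) 1 hD Matrix.PosDef.one
  set ν := sInf (spectrum ℝ ((Q - E) * (1 : Matrix (Fin n) (Fin n) ℝ)⁻¹))
  rw [tendsto_pi_nhds]
  intro r
  have hsq : Tendsto (fun i => (xst (k i) r) ^ 2) atTop (𝓝 0) := by
    refine squeeze_zero (fun i => sq_nonneg _) (g := fun i => a i / ν) ?_ ?_
    · intro i
      rw [le_div_iff₀ hν0]
      refine le_trans ?_ (hνD (xst (k i)))
      rw [mul_comm, Matrix.one_mulVec]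
      apply mul_le_mul_of_nonneg_left _ hν0.le
      rw [pow_two, dotProduct]
      exact Finset.single_le_sum (f := fun r => xst (k i) r * xst (k i) r)
        (fun r _ => mul_self_nonneg _) (Finset.mem_univ r)
    · simpa using hlim.div_const ν
  rw [Pi.zero_apply]
  apply tendsto_zero_iff_abs_tendsto_zero _ |>.2
  have := hsq.sqrt
  simpa [Function.comp_def, Real.sqrt_sq_eq_abs] using this
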